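/- arXiv:2301.05066 — 7 statements merged into one kernel-verified Lean document; each statement's English description precedes it below -/
import Mathlib

section
/- For every natural number m ≥ 1, the commutator of the symplectic Dirac operator D_s and its Fischer adjoint X_s, acting on complex polynomials in the 3m variables x_1,…,x_m, y_1,…,y_m, z_1,…,z_m, satisfies [D_s, X_s] = −(E_x + E_y + m·id). -/
open MvPolynomial Finset

noncomputable section

/-- Polynomials in 3m variables x_1..x_m, y_1..y_m, z_1..z_m. -/
abbrev PS (m : ℕ) : Type := MvPolynomial (Fin m ⊕ Fin m ⊕ Fin m) ℂ

variable (m : ℕ)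

/-- partial derivative ∂_{x_j} -/
def dx (j : Fin m) : Module.End ℂ (PS m) := (pderiv (Sum.inl j)).toLinearMap
/-- partial derivative ∂_{y_j} -/
def dy (j : Fin m) : Module.End ℂ (PS m) := (pderiv (Sum.inr (Sum.inl j))).toLinearMap
/-- partial derivative ∂_{z_j} -/
def dz (j : Fin m) : Module.End ℂ (PS m) := (pderiv (Sum.inr (Sum.inr j))).toLinearMap
/-- multiplication by x_j -/
def mx (j : Fin m) : Module.End ℂ (PS m) := LinearMap.mulLeft ℂ (X (Sum.inl j))
/-- multiplication by y_j -/
def my (j : Fin m) : Module.End ℂ (PS m) := LinearMap.mulLeft ℂ (X (Sum.inr (Sum.inl j)))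
/-- multiplication by z_j -/
def mz (j : Fin m) : Module.End ℂ (PS m) := LinearMap.mulLeft ℂ (X (Sum.inr (Sum.inr j)))

/-- symplectic Dirac operator D_s = ⟨z,∂_y⟩ − ⟨∂_z,∂_x⟩ -/
def Ds : Module.End ℂ (PS m) := (∑ j, mz m j * dy m j) - ∑ j, dz m j * dx m j
/-- adjoint X_s = ⟨y,∂_z⟩ + ⟨x,z⟩ -/
def Xs : Module.End ℂ (PS m) := (∑ j, my m j * dz m j) + ∑ j, mx m j * mz m j
/-- Euler operator in x -/
def Ex : Module.End ℂ (PS m) := ∑ j, mx m j * dx m j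
/-- Euler operator in y -/
def Ey : Module.End ℂ (PS m) := ∑ j, my m j * dy m j
/-- Euler operator in z -/
def Ez : Module.End ℂ (PS m) := ∑ j, mz m j * dz m j
/-- Δ_x -/
def lapX : Module.End ℂ (PS m) := ∑ j, dx m j * dx m j
/-- Δ_y -/
def lapY : Module.End ℂ (PS m) := ∑ j, dy m j * dy m j
/-- Δ_z -/
def lapZ : Module.End ℂ (PS m) := ∑ j, dz m j * dz m j
/-- ⟨∂_x,∂_y⟩ -/
def dxdy : Module.End ℂ (PS m) := ∑ j, dx m j * dy m j
/-- ⟨∂_y,∂_z⟩ -/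
def dydz : Module.End ℂ (PS m) := ∑ j, dy m j * dz m j
/-- ⟨∂_x,∂_z⟩ = ⟨∂_z,∂_x⟩ -/
def dxdz : Module.End ℂ (PS m) := ∑ j, dx m j * dz m j
/-- ⟨x,∂_y⟩ -/
def xdy : Module.End ℂ (PS m) := ∑ j, mx m j * dy m j
/-- ⟨y,∂_x⟩ -/
def ydx : Module.End ℂ (PS m) := ∑ j, my m j * dx m j
/-- ⟨x,∂_z⟩ -/
def xdz : Module.End ℂ (PS m) := ∑ j, mx m j * dz m j
/-- ⟨z,∂_x⟩ -/
def zdx : Module.End ℂ (PS m) := ∑ j, mz m j * dx m j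
/-- ⟨y,∂_z⟩ -/
def ydz : Module.End ℂ (PS m) := ∑ j, my m j * dz m j
/-- ⟨z,∂_y⟩ -/
def zdy : Module.End ℂ (PS m) := ∑ j, mz m j * dy m j
/-- multiplication by |x|² -/
def nx2 : Module.End ℂ (PS m) := ∑ j, mx m j * mx m j
/-- multiplication by |y|² -/
def ny2 : Module.End ℂ (PS m) := ∑ j, my m j * my m j
/-- multiplication by |z|² -/
def nz2 : Module.End ℂ (PS m) := ∑ j, mz m j * mz m j
/-- multiplication by ⟨x,y⟩ -/
def mxy : Module.End ℂ (PS m) := ∑ j, mx m j * my m j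
/-- multiplication by ⟨y,z⟩ -/
def myz : Module.End ℂ (PS m) := ∑ j, my m j * mz m j
/-- multiplication by ⟨x,z⟩ -/
def mxz : Module.End ℂ (PS m) := ∑ j, mx m j * mz m j
/-- L = ⟨x,∂_y⟩ − (1/2)Δ_z -/
def Lop : Module.End ℂ (PS m) := xdy m - (1/2 : ℂ) • lapZ m
/-- R = ⟨y,∂_x⟩ + (1/2)|z|² -/
def Rop : Module.End ℂ (PS m) := ydx m + (1/2 : ℂ) • nz2 m

lemma pderiv_pderiv_comm {R σ : Type*} [CommRing R] (i j : σ) (p : MvPolynomial σ R) :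
    pderiv i (pderiv j p) = pderiv j (pderiv i p) := by
  classical
  have h : ⁅pderiv (R := R) i, pderiv j⁆ = (0 : Derivation R (MvPolynomial σ R) _) := by
    refine MvPolynomial.derivation_ext fun k => ?_
    simp [Derivation.commutator_apply, pderiv_X, Pi.single_apply, apply_ite]
  simpa [Derivation.commutator_apply, sub_eq_zero] using congr($h p)

lemma lie_Ds_Xs_summand (m : ℕ) (j k : Fin m) :
    ⁅mz m j * dy m j - dz m j * dx m j, my m k * dz m k + mx m k * mz m k⁆ =
      if j = k then -(mx m j * dx m j + my m j * dy m j + 1) else 0 := by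
  refine LinearMap.ext fun p => ?_
  have h := pderiv_pderiv_comm (R := ℂ) (σ := Fin m ⊕ Fin m ⊕ Fin m)
  split_ifs with hjk
  · subst hjk
    simp only [Ring.lie_def, dx, dy, dz, mx, my, mz, LinearMap.sub_apply, LinearMap.add_apply,
      Module.End.mul_apply, Derivation.coeFn_coe, LinearMap.mulLeft_apply, map_add, map_sub,
      Derivation.leibniz, smul_eq_mul, pderiv_X, Pi.single_apply, LinearMap.neg_apply,
      Module.End.one_apply, h (.inr (.inl j)), h (.inr (.inr j)) (.inl j)]
    simp
    ring
  · simp only [Ring.lie_def, dx, dy, dz, mx, my, mz, LinearMap.sub_apply, LinearMap.add_apply,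
      Module.End.mul_apply, Derivation.coeFn_coe, LinearMap.mulLeft_apply, map_add, map_sub,
      Derivation.leibniz, smul_eq_mul, pderiv_X, Pi.single_apply, h (.inr (.inl j)),
      h (.inr (.inr j)) (.inl _), h (.inr (.inr k)) (.inl _), h (.inr (.inr k)) (.inr (.inr j))]
    simp [hjk, Ne.symm hjk]
    ring

/-- [D_s, X_s] = −(E_x + E_y + m·id). -/
theorem stmt0 : ∀ m : ℕ, 1 ≤ m →
    ⁅Ds m, Xs m⁆ = -(Ex m + Ey m + (m : ℂ) • (1 : Module.End ℂ (PS m))) := by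
  intro m _
  have h : ⁅Ds m, Xs m⁆ = ∑ j, ∑ k,
      ⁅mz m j * dy m j - dz m j * dx m j, my m k * dz m k + mx m k * mz m k⁆ := by
    rw [Ds, Xs, ← sum_sub_distrib, ← sum_add_distrib]
    let := LieRing.ofAssociativeRing (A := Module.End ℂ (PS m))
    exact sum_lie_sum (L := Module.End ℂ (PS m)) (M := Module.End ℂ (PS m)) univ univ _ _
  rw [h]
  simp [lie_Ds_Xs_summand, Ex, Ey, sum_add_distrib, Algebra.smul_def]
end
end

section
/- For every natural number m ≥ 1, the operators D_s and X_s acting on complex polynomials in x_1,…,x_m, y_1,…,y_m, z_1,…,z_m satisfy the grading relations [E_x + E_y, D_s] = −D_s and [E_x + E_y, X_s] = X_s; consequently X = √2·D_s, Y = √2·X_s and H = [X,Y] = −2(E_x + E_y + m·id) satisfy the sl(2) relations [H,X] = 2X and [H,Y] = −2Y. -/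
open MvPolynomial Finset

noncomputable section

variable (m : ℕ)

section

attribute [local instance] LieRing.ofAssociativeRing

theorem Ring.mul_lie_eq {A : Type*} [Ring A] (a b c : A) :
    ⁅a * b, c⁆ = a * ⁅b, c⁆ + ⁅a, c⁆ * b := by
  simp only [Ring.lie_def]
  noncomm_ring

theorem Ring.lie_mul_eq {A : Type*} [Ring A] (a b c : A) :
    ⁅a, b * c⁆ = ⁅a, b⁆ * c + b * ⁅a, c⁆ := by
  simp only [Ring.lie_def]
  noncomm_ring

theorem Module.End.smul_lie_smul {R V : Type*} [CommRing R] [AddCommGroup V] [Module R V]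
    (c d : R) (f g : Module.End R V) : ⁅c • f, d • g⁆ = (c * d) • ⁅f, g⁆ := by
  rw [smul_lie, lie_smul, smul_smul]

theorem Module.End.add_smul_one_lie {R V : Type*} [CommRing R] [AddCommGroup V] [Module R V]
    (c : R) (f g : Module.End R V) : ⁅f + c • (1 : Module.End R V), g⁆ = ⁅f, g⁆ := by
  simp [Ring.lie_def, add_mul, mul_add]

/-- Families `M`, `D` in a ring satisfying the canonical commutation relations. -/
structure IsWeylPair {A σ : Type*} [Ring A] [DecidableEq σ] (M D : σ → A) : Prop where
  lie_mul_mul : ∀ a b, ⁅M a, M b⁆ = 0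
  lie_deriv_deriv : ∀ a b, ⁅D a, D b⁆ = 0
  lie_deriv_mul : ∀ a b, ⁅D a, M b⁆ = if a = b then 1 else 0

namespace IsWeylPair

theorem lie_mul_deriv {A σ : Type*} [Ring A] [DecidableEq σ] {M D : σ → A}
    (h : IsWeylPair M D) (a b : σ) : ⁅M a, D b⁆ = if b = a then -1 else 0 := by
  rw [← lie_skew, h.lie_deriv_mul]
  split_ifs <;> simp

variable {A ι : Type*} [Ring A] [Fintype ι] [DecidableEq ι] {M D : ι ⊕ ι ⊕ ι → A}

theorem lie_euler_dirac (h : IsWeylPair M D) :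
    ⁅(∑ j, M (.inl j) * D (.inl j)) + ∑ j, M (.inr (.inl j)) * D (.inr (.inl j)),
      (∑ j, M (.inr (.inr j)) * D (.inr (.inl j))) - ∑ j, D (.inr (.inr j)) * D (.inl j)⁆ =
    -((∑ j, M (.inr (.inr j)) * D (.inr (.inl j))) - ∑ j, D (.inr (.inr j)) * D (.inl j)) := by
  simp [sum_lie, lie_sum, Ring.mul_lie_eq, Ring.lie_mul_eq, h.lie_mul_mul, h.lie_deriv_deriv,
    h.lie_deriv_mul, h.lie_mul_deriv]
  abel

theorem lie_euler_adjoint (h : IsWeylPair M D) :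
    ⁅(∑ j, M (.inl j) * D (.inl j)) + ∑ j, M (.inr (.inl j)) * D (.inr (.inl j)),
      (∑ j, M (.inr (.inl j)) * D (.inr (.inr j))) + ∑ j, M (.inl j) * M (.inr (.inr j))⁆ =
    (∑ j, M (.inr (.inl j)) * D (.inr (.inr j))) + ∑ j, M (.inl j) * M (.inr (.inr j)) := by
  simp [sum_lie, lie_sum, Ring.mul_lie_eq, Ring.lie_mul_eq, h.lie_mul_mul, h.lie_deriv_deriv,
    h.lie_deriv_mul, h.lie_mul_deriv]

theorem lie_dirac_adjoint (h : IsWeylPair M D) :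
    ⁅(∑ j, M (.inr (.inr j)) * D (.inr (.inl j))) - ∑ j, D (.inr (.inr j)) * D (.inl j),
      (∑ j, M (.inr (.inl j)) * D (.inr (.inr j))) + ∑ j, M (.inl j) * M (.inr (.inr j))⁆ =
    -((∑ j, M (.inl j) * D (.inl j)) + (∑ j, M (.inr (.inl j)) * D (.inr (.inl j))) +
      (Fintype.card ι : A)) := by
  have hcomm (j : ι) : D (.inr (.inr j)) * M (.inr (.inr j)) =
      M (.inr (.inr j)) * D (.inr (.inr j)) + 1 := by
    rw [← sub_eq_iff_eq_add', ← Ring.lie_def, h.lie_deriv_mul, if_pos rfl]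
  simp [sum_lie, lie_sum, Ring.mul_lie_eq, Ring.lie_mul_eq, h.lie_mul_mul, h.lie_deriv_deriv,
    h.lie_deriv_mul, h.lie_mul_deriv, hcomm, Finset.sum_add_distrib]
  abel

end IsWeylPair

end

theorem MvPolynomial.isWeylPair {R σ : Type*} [CommRing R] [DecidableEq σ] :
    IsWeylPair (A := Module.End R (MvPolynomial σ R))
      (fun a => LinearMap.mulLeft R (X a)) (fun a => (pderiv a).toLinearMap) where
  lie_mul_mul a b := by
    refine LinearMap.ext fun p => ?_
    change X a * (X b * p) - X b * (X a * p) = 0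
    ring
  lie_deriv_deriv a b := by
    have h : ⁅pderiv (R := R) a, pderiv (R := R) b⁆ = 0 := by
      refine MvPolynomial.derivation_ext fun i => ?_
      simp [Derivation.commutator_apply, pderiv_X, Pi.single_apply, apply_ite]
    refine LinearMap.ext fun p => ?_
    exact DFunLike.congr_fun h p
  lie_deriv_mul a b := by
    refine LinearMap.ext fun p => ?_
    change pderiv a (X b * p) - X b * pderiv a p = _
    split_ifs with h
    · subst h
      simp
    · simp [pderiv_X_of_ne (Ne.symm h)]

theorem lie_Ex_add_Ey_Ds : ⁅Ex m + Ey m, Ds m⁆ = -Ds m :=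
  MvPolynomial.isWeylPair.lie_euler_dirac

theorem lie_Ex_add_Ey_Xs : ⁅Ex m + Ey m, Xs m⁆ = Xs m :=
  MvPolynomial.isWeylPair.lie_euler_adjoint

theorem lie_Ds_Xs : ⁅Ds m, Xs m⁆ = -(Ex m + Ey m + (m : ℂ) • (1 : Module.End ℂ (PS m))) := by
  have hm : (m : ℂ) • (1 : Module.End ℂ (PS m)) = (Fintype.card (Fin m) : Module.End ℂ (PS m)) := by
    rw [Fintype.card_fin, Nat.cast_smul_eq_nsmul, nsmul_one]
  rw [hm]
  exact MvPolynomial.isWeylPair.lie_dirac_adjoint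

/-- grading relations and the sl(2) relations for X = √2 D_s, Y = √2 X_s,
H = [X,Y] = −2(E_x+E_y+m·id). -/
theorem stmt1 : ∀ m : ℕ, 1 ≤ m →
    (⁅Ex m + Ey m, Ds m⁆ = -(Ds m)) ∧
    (⁅Ex m + Ey m, Xs m⁆ = Xs m) ∧
    (∀ Xop Yop Hop : Module.End ℂ (PS m),
      Xop = ((Real.sqrt 2 : ℝ) : ℂ) • Ds m →
      Yop = ((Real.sqrt 2 : ℝ) : ℂ) • Xs m →
      Hop = ⁅Xop, Yop⁆ →
      Hop = (-2 : ℂ) • (Ex m + Ey m + (m : ℂ) • (1 : Module.End ℂ (PS m))) ∧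
      ⁅Hop, Xop⁆ = (2 : ℂ) • Xop ∧
      ⁅Hop, Yop⁆ = (-2 : ℂ) • Yop) := by
  intro m _
  refine ⟨lie_Ex_add_Ey_Ds m, lie_Ex_add_Ey_Xs m, ?_⟩
  rintro Xop Yop Hop rfl rfl hH
  have hsq : ((Real.sqrt 2 : ℝ) : ℂ) * ((Real.sqrt 2 : ℝ) : ℂ) = 2 := by
    rw [← Complex.ofReal_mul, Real.mul_self_sqrt zero_le_two, Complex.ofReal_ofNat]
  have hHop : Hop = (-2 : ℂ) • (Ex m + Ey m + (m : ℂ) • (1 : Module.End ℂ (PS m))) := by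
    rw [hH]
    refine (Module.End.smul_lie_smul _ _ _ _).trans ?_
    rw [hsq, lie_Ds_Xs, smul_neg]
    exact (neg_smul _ _).symm
  have hlie (c : ℂ) (B : Module.End ℂ (PS m)) : ⁅Hop, c • B⁆ = (-2 * c) • ⁅Ex m + Ey m, B⁆ := by
    rw [hHop]
    refine (Module.End.smul_lie_smul _ _ _ _).trans ?_
    exact congrArg _ (Module.End.add_smul_one_lie _ _ _)
  refine ⟨hHop, ?_, ?_⟩
  · rw [hlie, lie_Ex_add_Ey_Ds]
    module
  · rw [hlie, lie_Ex_add_Ey_Xs]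
    module
end
end

section
/- For every m ≥ 1 and all indices j, k ∈ {1,…,m}, the operator X_{jk} := x_j∂_{x_k} − y_k∂_{y_j} − z_k∂_{z_j} − (1/2)δ_{jk}·id commutes with the adjoint symplectic operator: [X_s, X_{jk}] = 0. -/
open MvPolynomial Finset

noncomputable section

variable (m : ℕ)

/-- X_{jk} := x_j∂_{x_k} − y_k∂_{y_j} − z_k∂_{z_j} − (1/2)δ_{jk}·id -/
def Xjk (j k : Fin m) : Module.End ℂ (PS m) :=
  mx m j * dx m k - my m k * dy m j - mz m k * dz m j -
    (if j = k then (1/2 : ℂ) else 0) • 1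

/-- The derivation `∑ i, y_i ∂_{z_i}`. -/
def ydzDerivation : Derivation ℂ (PS m) (PS m) :=
  ∑ i, (X (Sum.inr (Sum.inl i)) : PS m) • pderiv (Sum.inr (Sum.inr i))

/-- The derivation `x_j ∂_{x_k} - y_k ∂_{y_j} - z_k ∂_{z_j}`. -/
def glDerivation (j k : Fin m) : Derivation ℂ (PS m) (PS m) :=
  (X (Sum.inl j) : PS m) • pderiv (Sum.inl k) -
    (X (Sum.inr (Sum.inl k)) : PS m) • pderiv (Sum.inr (Sum.inl j)) -
    (X (Sum.inr (Sum.inr k)) : PS m) • pderiv (Sum.inr (Sum.inr j))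

/-- The polynomial `⟨x, z⟩`. -/
def xzPolynomial : PS m := ∑ i, X (Sum.inl i) * X (Sum.inr (Sum.inr i))

lemma ydzDerivation_apply (p : PS m) : ydzDerivation m p =
    ∑ i, X (Sum.inr (Sum.inl i)) * pderiv (Sum.inr (Sum.inr i)) p := by
  rw [ydzDerivation, ← Derivation.coeFnAddMonoidHom_apply, map_sum, Finset.sum_apply]
  rfl

@[simp]
lemma ydzDerivation_X_inl (i : Fin m) : ydzDerivation m (X (Sum.inl i)) = 0 := by
  simp [ydzDerivation_apply, pderiv_X]

@[simp]
lemma ydzDerivation_X_inr_inl (i : Fin m) :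
    ydzDerivation m (X (Sum.inr (Sum.inl i))) = 0 := by
  simp [ydzDerivation_apply, pderiv_X]

@[simp]
lemma ydzDerivation_X_inr_inr (i : Fin m) :
    ydzDerivation m (X (Sum.inr (Sum.inr i))) = X (Sum.inr (Sum.inl i)) := by
  simp [ydzDerivation_apply, pderiv_X, Pi.single_apply]

lemma glDerivation_X_inl (j k i : Fin m) :
    glDerivation m j k (X (Sum.inl i)) = if i = k then X (Sum.inl j) else 0 := by
  simp [glDerivation, pderiv_X, Pi.single_apply, eq_comm]

lemma glDerivation_X_inr_inl (j k i : Fin m) : glDerivation m j k (X (Sum.inr (Sum.inl i))) =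
    if i = j then -X (Sum.inr (Sum.inl k)) else 0 := by
  simp [glDerivation, pderiv_X, Pi.single_apply, apply_ite]

lemma glDerivation_X_inr_inr (j k i : Fin m) : glDerivation m j k (X (Sum.inr (Sum.inr i))) =
    if i = j then -X (Sum.inr (Sum.inr k)) else 0 := by
  simp [glDerivation, pderiv_X, Pi.single_apply, apply_ite]

lemma lie_ydzDerivation_glDerivation (j k : Fin m) :
    ⁅ydzDerivation m, glDerivation m j k⁆ = 0 := by
  refine MvPolynomial.derivation_ext ?_
  rintro (i | i | i)
  · simp [Derivation.commutator_apply, glDerivation_X_inl, apply_ite]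
  · simp [Derivation.commutator_apply, glDerivation_X_inr_inl, apply_ite]
  · by_cases h : i = j <;>
      simp [Derivation.commutator_apply, glDerivation_X_inr_inl, glDerivation_X_inr_inr, h]

lemma glDerivation_xzPolynomial (j k : Fin m) : glDerivation m j k (xzPolynomial m) = 0 := by
  simp [xzPolynomial, glDerivation_X_inl, glDerivation_X_inr_inr, Finset.sum_add_distrib, mul_comm]

lemma Xs_apply (p : PS m) : Xs m p = ydzDerivation m p + xzPolynomial m * p := by
  simp [Xs, ydzDerivation_apply, xzPolynomial, my, dz, mx, mz, LinearMap.sum_apply,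
    Finset.sum_mul, mul_assoc]

lemma Xjk_apply (j k : Fin m) (p : PS m) :
    Xjk m j k p = glDerivation m j k p - (if j = k then (1 / 2 : ℂ) else 0) • p := by
  simp only [Xjk, LinearMap.sub_apply, LinearMap.smul_apply, Module.End.one_apply]
  rfl

/-- [X_s, X_{jk}] = 0. -/
theorem stmt5 : ∀ m : ℕ, 1 ≤ m → ∀ j k : Fin m, ⁅Xs m, Xjk m j k⁆ = 0 := by
  intro m _ j k
  refine LinearMap.ext fun p => ?_
  have h : ydzDerivation m (glDerivation m j k p) - glDerivation m j k (ydzDerivation m p) = 0 := by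
    rw [← Derivation.commutator_apply, lie_ydzDerivation_glDerivation, Derivation.zero_apply]
  simp only [Ring.lie_def, LinearMap.sub_apply, Module.End.mul_apply, LinearMap.zero_apply,
    Xs_apply, Xjk_apply, map_sub, map_add, Derivation.map_smul, Derivation.leibniz,
    glDerivation_xzPolynomial, smul_eq_mul, mul_zero, add_zero, mul_smul_comm]
  linear_combination h
end
end

section
/- For every m ≥ 1, the operators L := Σ_j x_j∂_{y_j} − (1/2)Σ_j ∂_{z_j}² and R := Σ_j y_j∂_{x_j} + (1/2)(multiplication by Σ_j z_j²) acting on complex polynomials in x_1,…,x_m, y_1,…,y_m, z_1,…,z_m satisfy [L, R] = −(E_y − E_x + E_z + (m/2)·id). -/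
open MvPolynomial Finset

noncomputable section

variable (m : ℕ)

theorem pderiv_comm_apply {σ R : Type*} [CommRing R] (i j : σ) (p : MvPolynomial σ R) :
    pderiv i (pderiv j p) = pderiv j (pderiv i p) := by
  classical
  have h : ⁅(pderiv i : Derivation R (MvPolynomial σ R) (MvPolynomial σ R)),
      (pderiv j : Derivation R (MvPolynomial σ R) (MvPolynomial σ R))⁆ = 0 := by
    ext k
    simp [Derivation.commutator_apply, pderiv_X, Pi.single_apply, apply_ite]
  have := congrArg (fun D => D p) h
  simpa [Derivation.commutator_apply, sub_eq_zero] using this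

theorem ring_lie_sub_smul_add_smul {K A : Type*} [CommRing K] [Ring A] [Algebra K A]
    (r s : K) (a b c d : A) :
    ⁅a - r • b, c + s • d⁆ = ⁅a, c⁆ + s • ⁅a, d⁆ - r • ⁅b, c⁆ - (r * s) • ⁅b, d⁆ := by
  simp only [Ring.lie_def, sub_mul, mul_sub, add_mul, mul_add, smul_mul_assoc, mul_smul_comm]
  module

theorem ring_sum_lie_sum {ι κ A : Type*} [Ring A] (s : Finset ι) (t : Finset κ)
    (f : ι → A) (g : κ → A) :
    ⁅∑ i ∈ s, f i, ∑ j ∈ t, g j⁆ = ∑ i ∈ s, ∑ j ∈ t, ⁅f i, g j⁆ := by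
  simp only [Ring.lie_def, sum_sub_distrib, sum_mul_sum]
  rw [sum_comm (s := t)]

theorem lie_xdy_ydx_component (m : ℕ) (i j : Fin m) :
    ⁅mx m i * dy m i, my m j * dx m j⁆ =
      if j = i then mx m i * dx m i - my m i * dy m i else 0 := by
  refine LinearMap.ext fun p => ?_
  rw [Ring.lie_def]
  by_cases h : j = i
  · subst h
    simp [mx, my, dx, dy, Derivation.leibniz, pderiv_X,
      pderiv_comm_apply (Sum.inr (Sum.inl j)) (Sum.inl j) p]
    ring
  · simp [mx, my, dx, dy, Derivation.leibniz, pderiv_X, h, Ne.symm h,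
      pderiv_comm_apply (Sum.inr (Sum.inl i)) (Sum.inl j) p]
    ring

theorem lie_xdy_zz_component (m : ℕ) (i j : Fin m) :
    ⁅mx m i * dy m i, mz m j * mz m j⁆ = 0 := by
  refine LinearMap.ext fun p => ?_
  simp [Ring.lie_def, mx, mz, dy, Derivation.leibniz, pderiv_X]
  ring

theorem lie_dzdz_ydx_component (m : ℕ) (i j : Fin m) :
    ⁅dz m i * dz m i, my m j * dx m j⁆ = 0 := by
  refine LinearMap.ext fun p => ?_
  simp [Ring.lie_def, my, dx, dz, Derivation.leibniz, pderiv_X,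
    pderiv_comm_apply (Sum.inr (Sum.inr i)) (Sum.inl j)]

theorem lie_dzdz_zz_component (m : ℕ) (i j : Fin m) :
    ⁅dz m i * dz m i, mz m j * mz m j⁆ =
      if j = i then (4 : ℂ) • (mz m i * dz m i) + (2 : ℂ) • 1 else 0 := by
  refine LinearMap.ext fun p => ?_
  rw [Ring.lie_def]
  by_cases h : j = i
  · subst h
    simp [mz, dz, Derivation.leibniz, pderiv_X, MvPolynomial.smul_eq_C_mul]
    rw [show (C 4 : PS m) = 4 from map_ofNat C 4, show (C 2 : PS m) = 2 from map_ofNat C 2]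
    ring
  · simp [mz, dz, Derivation.leibniz, pderiv_X, h]

/-- [L, R] = −(E_y − E_x + E_z + (m/2)·id). -/
theorem stmt9 : ∀ m : ℕ, 1 ≤ m →
    ⁅Lop m, Rop m⁆ =
      -(Ey m - Ex m + Ez m + ((m : ℂ) / 2) • (1 : Module.End ℂ (PS m))) := by
  intro m _
  have h₁ : ⁅xdy m, ydx m⁆ = Ex m - Ey m := by
    refine (ring_sum_lie_sum _ _ _ _).trans ?_
    simp only [lie_xdy_ydx_component, sum_ite_eq', mem_univ, if_true, sum_sub_distrib, Ex, Ey]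
  have h₂ : ⁅xdy m, nz2 m⁆ = 0 := by
    refine (ring_sum_lie_sum _ _ _ _).trans ?_
    simp only [lie_xdy_zz_component, sum_const_zero]
  have h₃ : ⁅lapZ m, ydx m⁆ = 0 := by
    refine (ring_sum_lie_sum _ _ _ _).trans ?_
    simp only [lie_dzdz_ydx_component, sum_const_zero]
  have h₄ : ⁅lapZ m, nz2 m⁆ = (4 : ℂ) • Ez m + (2 * m : ℂ) • (1 : Module.End ℂ (PS m)) := by
    refine (ring_sum_lie_sum _ _ _ _).trans ?_
    simp only [lie_dzdz_zz_component, sum_ite_eq', mem_univ, if_true, sum_add_distrib,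
      ← smul_sum, Ez, sum_const, card_univ, Fintype.card_fin]
    module
  refine (ring_lie_sub_smul_add_smul (1 / 2 : ℂ) (1 / 2 : ℂ)
    (xdy m) (lapZ m) (ydx m) (nz2 m)).trans ?_
  rw [h₁, h₂, h₃, h₄]
  module
end
end

section
/- For every m ≥ 1, the operator L := Σ_j x_j∂_{y_j} − (1/2)Σ_j ∂_{z_j}² commutes with both the symplectic Dirac operator and its adjoint: [L, D_s] = 0 and [L, X_s] = 0. -/
open MvPolynomial Finset

noncomputable section

variable (m : ℕ)

/-- Partial derivatives of polynomials commute. -/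
theorem pderiv_pderiv_swap {R σ : Type*} [CommRing R] (i j : σ) (f : MvPolynomial σ R) :
    pderiv i (pderiv j f) = pderiv j (pderiv i f) := by
  classical
  have h : ⁅pderiv (R := R) i, pderiv (R := R) j⁆ = 0 := by
    ext k
    simp [Derivation.commutator_apply, pderiv_X, Pi.single_apply, apply_ite (pderiv (R := R) _)]
  have h' := congrArg (fun D => D f) h
  simpa [Derivation.commutator_apply, sub_eq_zero] using h'

theorem C_half_mul_two : (C (1 / 2) * 2 : PS m) = 1 := by
  rw [← map_ofNat C 2, ← C_mul]
  norm_num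

theorem commute_Lop_summand_Ds_summand (j k : Fin m) :
    Commute (mx m j * dy m j - (1/2 : ℂ) • (dz m j * dz m j))
      (mz m k * dy m k - dz m k * dx m k) := by
  refine LinearMap.ext fun f => ?_
  by_cases h : j = k
  · subst h
    simp [-one_div, mx, dy, dz, mz, dx, pderiv_X, smul_eq_C_mul]
    simp only [pderiv_pderiv_swap]
    linear_combination -(pderiv (Sum.inr (Sum.inl j)) (pderiv (Sum.inr (Sum.inr j)) f)) * C_half_mul_two m
  · simp [-one_div, mx, dy, dz, mz, dx, pderiv_X, smul_eq_C_mul, h, Ne.symm h]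
    simp only [pderiv_pderiv_swap]
    ring

theorem commute_Lop_summand_Xs_summand (j k : Fin m) :
    Commute (mx m j * dy m j - (1/2 : ℂ) • (dz m j * dz m j))
      (my m k * dz m k + mx m k * mz m k) := by
  refine LinearMap.ext fun f => ?_
  by_cases h : j = k
  · subst h
    simp [-one_div, mx, dy, dz, mz, my, pderiv_X, smul_eq_C_mul]
    simp only [pderiv_pderiv_swap]
    linear_combination -(X (Sum.inl j) * pderiv (Sum.inr (Sum.inr j)) f) * C_half_mul_two m
  · simp [-one_div, mx, dy, dz, mz, my, pderiv_X, smul_eq_C_mul, Ne.symm h]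
    simp only [pderiv_pderiv_swap]
    ring

theorem Lop_eq_sum :
    Lop m = ∑ j, (mx m j * dy m j - (1/2 : ℂ) • (dz m j * dz m j)) := by
  simp only [Lop, xdy, lapZ, sum_sub_distrib, smul_sum]

/-- [L, D_s] = 0 and [L, X_s] = 0. -/
theorem stmt11 : ∀ m : ℕ, 1 ≤ m →
    ⁅Lop m, Ds m⁆ = 0 ∧ ⁅Lop m, Xs m⁆ = 0 := by
  intro m _
  rw [Lop_eq_sum, Ds, Xs, ← sum_sub_distrib, ← sum_add_distrib]
  exact ⟨(Commute.sum_left _ _ _ fun j _ => Commute.sum_right _ _ _ fun k _ =>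
      commute_Lop_summand_Ds_summand m j k).lie_eq,
    (Commute.sum_left _ _ _ fun j _ => Commute.sum_right _ _ _ fun k _ =>
      commute_Lop_summand_Xs_summand m j k).lie_eq⟩
end
end

section
/- For every m ≥ 1, let T be the ℂ-linear span (inside the endomorphisms of the polynomial space P) of the 15 operators Δ_x, ⟨∂_x,∂_y⟩, Δ_y, ⟨z,∂_x⟩, ⟨z,∂_y⟩+⟨∂_z,∂_x⟩, ⟨∂_y,∂_z⟩, ⟨y,∂_x⟩−|z|², E_x−E_y+2E_z+m·id, ⟨x,∂_y⟩+Δ_z, ⟨y,z⟩, ⟨x,z⟩−⟨y,∂_z⟩, ⟨x,∂_z⟩, |y|², ⟨x,y⟩, |x|². Then for each g ∈ {D_s, X_s, L, R} and each operator Q among these 15, the commutator [g, Q] again lies in T; i.e., so(4) = Alg(D_s, X_s) ⊕ Alg(L, R) is reductive in sp(6) with complement T. -/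
open MvPolynomial Finset

noncomputable section

variable (m : ℕ)

/-- The 15 operators spanning the complement 𝔱 of so(4) inside sp(6). -/
def Tset : Set (Module.End ℂ (PS m)) :=
  { lapX m, dxdy m, lapY m,
    zdx m, zdy m + dxdz m, dydz m,
    ydx m - nz2 m, Ex m - Ey m + (2 : ℂ) • Ez m + (m : ℂ) • 1, xdy m + lapZ m,
    myz m, mxz m - ydz m, xdz m,
    ny2 m, mxy m, nx2 m }

/-- The standard symplectic form on `ℂ⁶`: the commutators of the Weyl generators
`x, y, z, ∂_x, ∂_y, ∂_z`, in this order. -/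
def symplecticForm (i k : Fin 6) : ℂ :=
  if (i : ℕ) + 3 = k then -1 else if (k : ℕ) + 3 = i then 1 else 0

section Weyl

attribute [local instance] LieRing.ofAssociativeRing

variable {A : Type*} [Ring A] [Algebra ℂ A] {n : ℕ} {w : Fin 6 → Fin n → A}

/-- `w` satisfies the canonical commutation relations. -/
def IsWeylSystem (w : Fin 6 → Fin n → A) : Prop :=
  ∀ i k j l, ⁅w i j, w k l⁆ = if j = l then symplecticForm i k • (1 : A) else 0

/-- The quadratic element `∑ j, w_{i,j} w_{k,j}`. -/
def contraction (w : Fin 6 → Fin n → A) (i k : Fin 6) : A := ∑ j, w i j * w k j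

theorem mul_lie_mul {R : Type*} [Ring R] (a b c d : R) :
    ⁅a * b, c * d⁆ = a * ⁅b, c⁆ * d + ⁅a, c⁆ * b * d + c * a * ⁅b, d⁆ + c * ⁅a, d⁆ * b := by
  simp only [Ring.lie_def]
  noncomm_ring

theorem lie_one {R : Type*} [Ring R] (a : R) : ⁅a, (1 : R)⁆ = 0 :=
  (Commute.one_right a).lie_eq

theorem IsWeylSystem.lie_contraction (hw : IsWeylSystem w) (a b c d : Fin 6) :
    ⁅contraction w a b, contraction w c d⁆ =
      symplecticForm b c • contraction w a d + symplecticForm a c • contraction w b d +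
        symplecticForm b d • contraction w c a + symplecticForm a d • contraction w c b := by
  have key (j l : Fin n) : ⁅w a j * w b j, w c l * w d l⁆ =
      if j = l then symplecticForm b c • (w a j * w d j) + symplecticForm a c • (w b j * w d j) +
        symplecticForm b d • (w c j * w a j) + symplecticForm a d • (w c j * w b j) else 0 := by
    rw [mul_lie_mul, hw, hw, hw, hw]
    split_ifs with h
    · subst h; simp
    · simp
  simp only [contraction, sum_lie, lie_sum, key, sum_ite_eq', mem_univ, if_true,
    smul_sum, sum_add_distrib]

theorem IsWeylSystem.contraction_comm (hw : IsWeylSystem w) (a b : Fin 6) :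
    contraction w a b = contraction w b a + ((n : ℂ) * symplecticForm a b) • 1 := by
  have h (j : Fin n) : w a j * w b j = w b j * w a j + symplecticForm a b • 1 := by
    rw [← sub_eq_iff_eq_add', ← Ring.lie_def, hw, if_pos rfl]
  simp [contraction, h, sum_add_distrib, mul_smul, Nat.cast_smul_eq_nsmul]

theorem IsWeylSystem.contraction_swap (hw : IsWeylSystem w) {a b : Fin 6} (_ : b < a) :
    contraction w a b = contraction w b a + ((n : ℂ) * symplecticForm a b) • 1 :=
  hw.contraction_comm a b

/-- The weight basis of the complement of `so(4)`: rows are raised by `L`,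
columns by the symplectic Dirac operator. -/
def complementBasis (w : Fin 6 → Fin n → A) : Matrix (Fin 3) (Fin 5) A :=
  !![contraction w 1 1, contraction w 1 2, contraction w 1 3 - contraction w 2 2,
      contraction w 2 3, contraction w 3 3;
    contraction w 0 1, contraction w 0 2 - contraction w 1 5,
      contraction w 0 3 - contraction w 1 4 + (2 : ℂ) • contraction w 2 5 + (n : ℂ) • 1,
      contraction w 2 4 + contraction w 3 5, contraction w 3 4;
    contraction w 0 0, contraction w 0 5, contraction w 0 4 + contraction w 5 5,
      contraction w 4 5, contraction w 4 4]

theorem IsWeylSystem.Ds_lie_complementBasis (hw : IsWeylSystem w) (a : Fin 3) (b : Fin 5) :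
    ⁅contraction w 2 4 - contraction w 5 3, complementBasis w a b⁆ =
      (!![2, -1, 3, -1, 0; 1, -1, -3, -2, 0; -2, -1, -3, -1, 0] : Matrix (Fin 3) (Fin 5) ℂ) a b •
        complementBasis w a (b + 1) := by
  fin_cases a <;> fin_cases b <;>
    simp [complementBasis, hw.lie_contraction, hw.contraction_swap, symplecticForm, lie_one] <;>
    module

theorem IsWeylSystem.Xs_lie_complementBasis (hw : IsWeylSystem w) (a : Fin 3) (b : Fin 5) :
    ⁅contraction w 1 5 + contraction w 0 2, complementBasis w a b⁆ =
      (!![0, 1, -3, 1, -2; 0, 2, -3, -1, -1; 0, -1, -3, -1, -2] : Matrix (Fin 3) (Fin 5) ℂ) a b •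
        complementBasis w a (b - 1) := by
  fin_cases a <;> fin_cases b <;>
    simp [complementBasis, hw.lie_contraction, hw.contraction_swap, symplecticForm, lie_one] <;>
    module

theorem IsWeylSystem.Lop_lie_complementBasis (hw : IsWeylSystem w) (a : Fin 3) (b : Fin 5) :
    ⁅contraction w 0 4 - (1 / 2 : ℂ) • contraction w 5 5, complementBasis w a b⁆ =
      (!![2, 1, 1, -1, -2; 1, -2, -2, -2, -1; 0, 0, 0, 0, 0] : Matrix (Fin 3) (Fin 5) ℂ) a b •
        complementBasis w (a + 1) b := by
  fin_cases a <;> fin_cases b <;>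
    simp [complementBasis, hw.lie_contraction, hw.contraction_swap, symplecticForm, lie_one] <;>
    module

theorem IsWeylSystem.Rop_lie_complementBasis (hw : IsWeylSystem w) (a : Fin 3) (b : Fin 5) :
    ⁅contraction w 1 3 + (1 / 2 : ℂ) • contraction w 2 2, complementBasis w a b⁆ =
      (!![0, 0, 0, 0, 0; 1, 2, 2, -2, -1; 2, -1, -1, -1, -2] : Matrix (Fin 3) (Fin 5) ℂ) a b •
        complementBasis w (a - 1) b := by
  fin_cases a <;> fin_cases b <;>
    simp [complementBasis, hw.lie_contraction, hw.contraction_swap, symplecticForm, lie_one] <;>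
    module

end Weyl

theorem lie_mulLeft_mulLeft {σ : Type*} (p q : MvPolynomial σ ℂ) :
    ⁅LinearMap.mulLeft ℂ p, LinearMap.mulLeft ℂ q⁆ = 0 := by
  refine LinearMap.ext fun r => ?_
  simp [Ring.lie_def, mul_left_comm]

theorem lie_pderiv_pderiv {σ : Type*} (i k : σ) :
    ⁅(pderiv i : Derivation ℂ (MvPolynomial σ ℂ) _).toLinearMap,
      (pderiv k : Derivation ℂ (MvPolynomial σ ℂ) _).toLinearMap⁆ = 0 := by
  classical
  have h : ⁅(pderiv i : Derivation ℂ (MvPolynomial σ ℂ) _), pderiv k⁆ = 0 :=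
    derivation_ext fun l => by
      rw [Derivation.commutator_apply]
      simp [pderiv_X, Pi.single_apply, apply_ite]
  exact congrArg Derivation.toLinearMap h

theorem lie_pderiv_mulLeft_X {σ : Type*} [DecidableEq σ] (i k : σ) :
    ⁅(pderiv i : Derivation ℂ (MvPolynomial σ ℂ) _).toLinearMap,
      LinearMap.mulLeft ℂ (X k : MvPolynomial σ ℂ)⁆ = if i = k then 1 else 0 := by
  refine LinearMap.ext fun p => ?_
  by_cases h : i = k
  · subst h; simp [Ring.lie_def]
  · simp [Ring.lie_def, pderiv_X_of_ne (Ne.symm h), h]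

theorem lie_mulLeft_X_pderiv {σ : Type*} [DecidableEq σ] (i k : σ) :
    ⁅LinearMap.mulLeft ℂ (X k : MvPolynomial σ ℂ),
      (pderiv i : Derivation ℂ (MvPolynomial σ ℂ) _).toLinearMap⁆ =
        if i = k then (-1 : ℂ) • 1 else 0 := by
  refine LinearMap.ext fun p => ?_
  by_cases h : i = k
  · subst h; simp [Ring.lie_def]
  · simp [Ring.lie_def, pderiv_X_of_ne (Ne.symm h), h]

/-- The operators `x_j, y_j, z_j, ∂_{x_j}, ∂_{y_j}, ∂_{z_j}` on polynomials. -/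
def weylGen (i : Fin 6) (j : Fin m) : Module.End ℂ (PS m) :=
  ![mx m j, my m j, mz m j, dx m j, dy m j, dz m j] i

theorem isWeylSystem_weylGen : IsWeylSystem (weylGen m) := by
  intro i k j l
  fin_cases i <;> fin_cases k <;>
    simp [weylGen, symplecticForm, mx, my, mz, dx, dy, dz, lie_mulLeft_mulLeft,
      lie_pderiv_pderiv, lie_pderiv_mulLeft_X, lie_mulLeft_X_pderiv, eq_comm]
  all_goals exact if_congr Iff.rfl (LinearMap.ext fun p => neg_one_smul ℂ p) rfl

theorem range_fin_three_prod_fin_five {α : Type*} (T : Fin 3 → Fin 5 → α) :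
    Set.range (fun p : Fin 3 × Fin 5 => T p.1 p.2) =
      {T 0 4, T 1 4, T 2 4, T 0 3, T 1 3, T 2 3, T 0 2, T 1 2, T 2 2,
        T 0 1, T 1 1, T 2 1, T 0 0, T 1 0, T 2 0} := by
  ext t
  constructor
  · rintro ⟨⟨a, b⟩, rfl⟩
    fin_cases a <;> fin_cases b <;> simp
  · rintro (rfl | rfl | rfl | rfl | rfl | rfl | rfl | rfl | rfl | rfl | rfl | rfl | rfl | rfl | rfl)
    all_goals exact Set.mem_range_self (f := fun p : Fin 3 × Fin 5 => T p.1 p.2) (_, _)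

theorem Tset_eq_range :
    Tset m = Set.range fun p : Fin 3 × Fin 5 => complementBasis (weylGen m) p.1 p.2 :=
  (range_fin_three_prod_fin_five (complementBasis (weylGen m))).symm

/-- for each g among D_s, X_s, L, R and each Q among the 15 operators,
[g, Q] lies in the span T; i.e. so(4) is reductive in sp(6) with complement T. -/
theorem stmt15 : ∀ m : ℕ, 1 ≤ m →
    ∀ g ∈ ({Ds m, Xs m, Lop m, Rop m} : Set (Module.End ℂ (PS m))),
    ∀ Q ∈ Tset m, ⁅g, Q⁆ ∈ Submodule.span ℂ (Tset m) := by
  intro m _ g hg Q hQ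
  have hw := isWeylSystem_weylGen m
  rw [Tset_eq_range] at hQ ⊢
  obtain ⟨⟨a, b⟩, rfl⟩ := hQ
  have smul_mem (c : ℂ) (a : Fin 3) (b : Fin 5) := Submodule.smul_mem _ c
    (Submodule.subset_span (R := ℂ) (Set.mem_range_self
      (f := fun p : Fin 3 × Fin 5 => complementBasis (weylGen m) p.1 p.2) (a, b)))
  rcases hg with rfl | rfl | rfl | rfl
  · exact (hw.Ds_lie_complementBasis a b).symm ▸ smul_mem _ _ _
  · exact (hw.Xs_lie_complementBasis a b).symm ▸ smul_mem _ _ _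
  · exact (hw.Lop_lie_complementBasis a b).symm ▸ smul_mem _ _ _
  · exact (hw.Rop_lie_complementBasis a b).symm ▸ smul_mem _ _ _
end
end

section
/- For every m ≥ 1, the symplectic Dirac operator D_s satisfies the ladder relations [D_s, |y|²] = 2⟨y,z⟩ and [D_s, ⟨y,z⟩] = −(⟨y,∂_x⟩ − |z|²), where |y|², ⟨y,z⟩ and |z|² are the multiplication operators by Σ_j y_j², Σ_j y_j z_j and Σ_j z_j² respectively, and ⟨y,∂_x⟩ := Σ_j y_j∂_{x_j}. (These are instances of the commutation pattern [D_s, Q_{a,b}] ∝ Q_{a,b−2} used in the recursive proof of the kernel theorem.) -/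
open MvPolynomial Finset

noncomputable section

variable (m : ℕ)

/-- The commutator of `D_s` with multiplication by a polynomial not involving the `x_j`. -/
theorem Ds_lie_mulLeft (f : PS m) (hf : ∀ j, pderiv (Sum.inl j) f = 0) :
    ⁅Ds m, LinearMap.mulLeft ℂ f⁆ =
      LinearMap.mulLeft ℂ (∑ j : Fin m,
        X (Sum.inr (Sum.inr j)) * pderiv (Sum.inr (Sum.inl j)) f) -
      ∑ j, LinearMap.mulLeft ℂ (pderiv (Sum.inr (Sum.inr j)) f) * dx m j := by
  refine LinearMap.ext fun p => ?_
  simp only [Ring.lie_def, Ds, mz, dy, dz, dx, LinearMap.sub_apply, Module.End.mul_apply,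
    LinearMap.sum_apply, LinearMap.mulLeft_apply, Derivation.coeFn_coe, Derivation.leibniz,
    hf, smul_eq_mul, mul_zero, add_zero, map_add, mul_sub, Finset.mul_sum, Finset.sum_mul]
  simp only [← Finset.sum_sub_distrib]
  refine Finset.sum_congr rfl fun j _ => ?_
  ring

theorem ny2_eq_mulLeft :
    ny2 m = LinearMap.mulLeft ℂ (∑ j, X (Sum.inr (Sum.inl j)) * X (Sum.inr (Sum.inl j))) := by
  refine LinearMap.ext fun p => ?_
  simp [ny2, my, Finset.sum_mul, mul_assoc]

theorem myz_eq_mulLeft :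
    myz m = LinearMap.mulLeft ℂ (∑ j, X (Sum.inr (Sum.inl j)) * X (Sum.inr (Sum.inr j))) := by
  refine LinearMap.ext fun p => ?_
  simp [myz, my, mz, Finset.sum_mul, mul_assoc]

/-- ladder relations [D_s, |y|²] = 2⟨y,z⟩ and [D_s, ⟨y,z⟩] = −(⟨y,∂_x⟩ − |z|²). -/
theorem stmt18 : ∀ m : ℕ, 1 ≤ m →
    ⁅Ds m, ny2 m⁆ = (2 : ℂ) • myz m ∧ ⁅Ds m, myz m⁆ = -(ydx m - nz2 m) := by
  intro m _
  constructor
  · rw [ny2_eq_mulLeft, Ds_lie_mulLeft]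
    · refine LinearMap.ext fun p => ?_
      simp [myz, my, mz, dx, pderiv_X, Pi.single_apply, Finset.sum_mul, Finset.smul_sum,
        Finset.sum_add_distrib, mul_add, add_mul, two_smul, mul_assoc, mul_left_comm]
    · simp [pderiv_X]
  · rw [myz_eq_mulLeft, Ds_lie_mulLeft]
    · refine LinearMap.ext fun p => ?_
      simp [ydx, nz2, my, mz, dx, pderiv_X, Pi.single_apply, Finset.sum_mul, mul_assoc]
    · simp [pderiv_X]
end
end
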